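/- arXiv:0908.3340 — 4 statements merged into one kernel-verified Lean document; each statement's English description precedes it below -/
import Mathlib

section
/- Every element of GSp6(k) lies in the double coset Q3ᵀ·σ·Q3 for exactly one σ ∈ Σ = {1, b, b·c·b, b·a·c·b, b·c·a·b·a·c·b}; that is, GSp6(k) is the disjoint union over σ ∈ Σ of the double cosets Q3ᵀ·σ·Q3. -/
open Matrix Pointwise

/-- 2×2 matrices over `k`. -/
abbrev M2 (k : Type*) [Field k] := Matrix (Fin 2) (Fin 2) k

/-- 6×6 matrices over `k`. -/
abbrev M6 (k : Type*) [Field k] := Matrix (Fin 6) (Fin 6) k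

variable {k : Type*} [Field k]

/-- The 2×2 matrix `J = [[0,-1],[1,0]]`. -/
def Jmat : M2 k := !![0, -1; 1, 0]

/-- Build a 6×6 matrix from a 3×3 array of 2×2 blocks. -/
def blk (M : Fin 3 → Fin 3 → M2 k) : M6 k :=
  Matrix.of fun i j =>
    M ⟨i.val / 2, by have := i.isLt; omega⟩ ⟨j.val / 2, by have := j.isLt; omega⟩
      ⟨i.val % 2, by have := i.isLt; omega⟩ ⟨j.val % 2, by have := j.isLt; omega⟩

/-- Block diagonal 6×6 matrix with 2×2 blocks `g`, `h`, `m`. -/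
def bdiag (g h m : M2 k) : M6 k := blk ![![g, 0, 0], ![0, h, 0], ![0, 0, m]]

/-- The block upper unitriangular matrix `[[I,X,Z],[0,I,Y],[0,0,I]]`. -/
def Umat (X Y Z : M2 k) : M6 k := blk ![![1, X, Z], ![0, 1, Y], ![0, 0, 1]]

/-- The 6×6 matrix `J3` with 2×2 blocks `[[0,0,J],[0,J,0],[J,0,0]]`. -/
def J3 : M6 k := blk ![![0, 0, Jmat], ![0, Jmat, 0], ![Jmat, 0, 0]]

/-- The group of symplectic similitudes `GSp6(k)`, as a subset of the 6×6 matrices. -/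
def GSp6 (k : Type*) [Field k] : Set (M6 k) :=
  {g | IsUnit g ∧ ∃ l : kˣ, g * J3 * gᵀ = (l : k) • (J3 : M6 k)}

/-- The Levi subgroup `L3 = { blockdiag(g, h, det(g⁻¹h)·g) }`. -/
def L3 (k : Type*) [Field k] : Set (M6 k) :=
  {m | ∃ g h : M2 k, IsUnit g ∧ IsUnit h ∧ m = bdiag g h ((g⁻¹ * h).det • g)}

/-- The unipotent radical `U3`. -/
def U3 (k : Type*) [Field k] : Set (M6 k) :=
  {m | ∃ X Y Z : M2 k, X * Jmat + Jmat * Yᵀ = 0 ∧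
    Z * Jmat + Jmat * Zᵀ = -(X * Jmat * Xᵀ) ∧ m = Umat X Y Z}

/-- The parabolic subgroup `Q3 = L3 · U3`. -/
def Q3 (k : Type*) [Field k] : Set (M6 k) := L3 k * U3 k

/-- The diagonal embedding `Δ(g) = blockdiag(g,g,g)`. -/
def Dmat (g : M2 k) : M6 k := bdiag g g g

/-- The diagonal copy `Δ(GL2)` of `GL2` in `GSp6`. -/
def DeltaGL2 (k : Type*) [Field k] : Set (M6 k) := {m | ∃ g : M2 k, IsUnit g ∧ m = Dmat g}

/-- The embedding `η(g) = blockdiag(I, g, det(g)·I)`. -/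
def etaMat (g : M2 k) : M6 k := bdiag 1 g (g.det • (1 : M2 k))

/-- The copy `η(GL2)` of `GL2` in `GSp6`. -/
def etaGL2 (k : Type*) [Field k] : Set (M6 k) := {m | ∃ g : M2 k, IsUnit g ∧ m = etaMat g}

/-- The Shalika subgroup `S = Δ(GL2) · U3`. -/
def Sgrp (k : Type*) [Field k] : Set (M6 k) := DeltaGL2 k * U3 k

/-- For a subset `H` of the 6×6 matrices, `Hᵀ = { hᵀ : h ∈ H }`. -/
def setT (H : Set (M6 k)) : Set (M6 k) := Matrix.transpose '' H

/-- The Weyl element `a = blockdiag(J, I, J)`. -/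
def amat : M6 k := bdiag Jmat 1 Jmat

/-- The Weyl element `c = blockdiag(I, J, I)`. -/
def cmat : M6 k := bdiag 1 Jmat 1

/-- The Weyl element `b`. -/
def bmat : M6 k :=
  !![1,0,0,0,0,0; 0,0,1,0,0,0; 0,-1,0,0,0,0; 0,0,0,0,1,0; 0,0,0,-1,0,0; 0,0,0,0,0,1]

/-- The set `Σ = {1, b, b·c·b, b·a·c·b, b·c·a·b·a·c·b}` of double coset representatives. -/
def SigmaSet (k : Type*) [Field k] : Set (M6 k) :=
  {1, bmat, bmat * cmat * bmat, bmat * amat * cmat * bmat,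
    bmat * cmat * amat * bmat * amat * cmat * bmat}


/-- The `(i,j)` block. -/
def bk (g : M6 k) (i j : Fin 3) : M2 k :=
  Matrix.of fun a b => g ⟨2 * i.val + a.val, by omega⟩ ⟨2 * j.val + b.val, by omega⟩

lemma bk_blk (M : Fin 3 → Fin 3 → M2 k) (i j : Fin 3) : bk (blk M) i j = M i j := by
  ext a b
  simp only [bk, blk, Matrix.of_apply]
  congr <;> omega

lemma bk_ext {g h : M6 k} (H : ∀ i j, bk g i j = bk h i j) : g = h := by
  ext i j
  have := congrFun (congrFun (H ⟨i.val / 2, by omega⟩ ⟨j.val / 2, by omega⟩) ⟨i.val % 2, by omega⟩)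
    ⟨j.val % 2, by omega⟩
  simp only [bk, Matrix.of_apply] at this
  convert this using 2 <;> ext <;> simp <;> omega

lemma bk_mul (g h : M6 k) (i j : Fin 3) :
    bk (g * h) i j = bk g i 0 * bk h 0 j + bk g i 1 * bk h 1 j + bk g i 2 * bk h 2 j := by
  ext a b
  simp [bk, Matrix.mul_apply, Fin.sum_univ_succ]
  simp only [← add_assoc]

lemma bk_transpose (g : M6 k) (i j : Fin 3) : bk gᵀ i j = (bk g j i)ᵀ := rfl

lemma bk_smul (c : k) (g : M6 k) (i j : Fin 3) : bk (c • g) i j = c • bk g i j := rfl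

lemma bk_one (i j : Fin 3) : bk (1 : M6 k) i j = if i = j then 1 else 0 := by
  ext a b
  fin_cases i <;> fin_cases j <;> fin_cases a <;> fin_cases b <;> simp [bk, Matrix.one_apply]

lemma bk_J3 (i j : Fin 3) : bk (J3 : M6 k) i j =
    (![![0, 0, Jmat], ![0, Jmat, 0], ![Jmat, 0, 0]] : Fin 3 → Fin 3 → M2 k) i j := bk_blk _ _ _

lemma J_sq : (Jmat : M2 k) * Jmat = -1 := by
  ext a b; fin_cases a <;> fin_cases b <;> simp [Jmat]

lemma J_tr : (Jmat : M2 k)ᵀ = -Jmat := by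
  ext a b; fin_cases a <;> fin_cases b <;> simp [Jmat]

lemma J_conj (A : M2 k) : A * Jmat * Aᵀ = A.det • Jmat := by
  ext a b; fin_cases a <;> fin_cases b <;>
    simp [Jmat, Matrix.mul_apply, Fin.sum_univ_two, Matrix.det_fin_two] <;> ring

lemma J3_sq : (J3 : M6 k) * J3 = -1 := by
  apply bk_ext
  intro i j
  have h : bk (-1 : M6 k) i j = - bk (1 : M6 k) i j := rfl
  rw [h]
  fin_cases i <;> fin_cases j <;> simp [bk_mul, bk_J3, bk_one, J_sq]

lemma J3_tr : (J3 : M6 k)ᵀ = -J3 := by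
  apply bk_ext
  intro i j
  have h : bk (-J3 : M6 k) i j = - bk (J3 : M6 k) i j := rfl
  rw [h, bk_transpose]
  fin_cases i <;> fin_cases j <;> simp [bk_J3, J_tr]

lemma mem_GSp {g : M6 k} : g ∈ GSp6 k ↔ ∃ l : k, l ≠ 0 ∧ g * J3 * gᵀ = l • (J3 : M6 k) := by
  constructor
  · rintro ⟨_, l, h⟩
    exact ⟨l, l.ne_zero, h⟩
  · rintro ⟨l, hl, h⟩
    refine ⟨?_, Units.mk0 l hl, h⟩
    have : g * (J3 * gᵀ * (-l⁻¹ • J3)) = 1 := by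
      rw [← mul_assoc, ← mul_assoc, h]
      simp [J3_sq, hl]
    exact IsUnit.of_mul_eq_one _ this

/-- The relation with explicit inverse. -/
lemma GSp_inv_eq {g : M6 k} {l : k} (hl : l ≠ 0) (h : g * J3 * gᵀ = l • (J3 : M6 k)) :
    g⁻¹ = -l⁻¹ • (J3 * gᵀ * J3) := by
  apply Matrix.inv_eq_right_inv
  rw [Matrix.mul_smul, ← mul_assoc, ← mul_assoc, h]
  simp [J3_sq, hl]

lemma GSp_isUnit {g : M6 k} (h : g ∈ GSp6 k) : IsUnit g := h.1

lemma GSp_det {g : M6 k} (h : g ∈ GSp6 k) : IsUnit g.det := (Matrix.isUnit_iff_isUnit_det _).1 h.1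

lemma GSp_mul {g h : M6 k} (hg : g ∈ GSp6 k) (hh : h ∈ GSp6 k) : g * h ∈ GSp6 k := by
  rw [mem_GSp] at *
  obtain ⟨l, hl, e⟩ := hg
  obtain ⟨m, hm, f⟩ := hh
  refine ⟨m * l, mul_ne_zero hm hl, ?_⟩
  calc g * h * J3 * (g * h)ᵀ = g * (h * J3 * hᵀ) * gᵀ := by
        simp [Matrix.transpose_mul, mul_assoc]
    _ = m • (g * J3 * gᵀ) := by rw [f]; simp
    _ = _ := by rw [e, smul_smul]

lemma GSp_inv {g : M6 k} (hg : g ∈ GSp6 k) : g⁻¹ ∈ GSp6 k := by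
  have hd := GSp_det hg
  have hd' : IsUnit (gᵀ).det := by rwa [Matrix.det_transpose]
  rw [mem_GSp] at *
  obtain ⟨l, hl, e⟩ := hg
  refine ⟨l⁻¹, inv_ne_zero hl, ?_⟩
  have e2 : (J3 : M6 k) = l⁻¹ • (g * J3 * gᵀ) := by rw [e, smul_smul, inv_mul_cancel₀ hl, one_smul]
  conv_lhs => rw [e2]
  rw [Matrix.transpose_nonsing_inv]
  simp only [Matrix.mul_smul, Matrix.smul_mul, mul_assoc]
  rw [Matrix.mul_nonsing_inv _ hd', ← mul_assoc, Matrix.nonsing_inv_mul _ hd]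
  simp

lemma GSp_tr {g : M6 k} (hg : g ∈ GSp6 k) : gᵀ ∈ GSp6 k := by
  have h2 := GSp_inv hg
  have hd := GSp_det hg
  rw [mem_GSp] at *
  obtain ⟨l, hl, e⟩ := hg
  refine ⟨l, hl, ?_⟩
  have e3 := Matrix.nonsing_inv_mul _ hd
  rw [GSp_inv_eq hl e] at e3
  have e4 : (J3 * gᵀ * J3) * g = -l • 1 := by
    rw [← e3]; simp [hl, smul_smul]
  have e5 : J3 * ((J3 * gᵀ * J3) * g) = -l • J3 := by rw [e4]; simp
  rw [← mul_assoc, ← mul_assoc, ← mul_assoc, J3_sq] at e5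
  rw [Matrix.transpose_transpose]
  simpa using e5

lemma GSp_rel {g : M6 k} (hg : g ∈ GSp6 k) : ∃ l : k, l ≠ 0 ∧ ∀ i j,
    bk g i 0 * Jmat * (bk g j 2)ᵀ + bk g i 1 * Jmat * (bk g j 1)ᵀ + bk g i 2 * Jmat * (bk g j 0)ᵀ
      = l • bk (J3 : M6 k) i j := by
  obtain ⟨l, hl, e⟩ := mem_GSp.1 hg
  refine ⟨l, hl, fun i j => ?_⟩
  rw [← bk_smul, ← e]
  simp [bk_mul, bk_transpose, bk_J3]
  abel

lemma GSp_of_rel {g : M6 k} (l : k) (hl : l ≠ 0) (H : ∀ i j,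
    bk g i 0 * Jmat * (bk g j 2)ᵀ + bk g i 1 * Jmat * (bk g j 1)ᵀ + bk g i 2 * Jmat * (bk g j 0)ᵀ
      = l • bk (J3 : M6 k) i j) : g ∈ GSp6 k := by
  refine mem_GSp.2 ⟨l, hl, bk_ext fun i j => ?_⟩
  rw [bk_smul, ← H]
  simp [bk_mul, bk_transpose, bk_J3]
  abel

lemma isUnit_iff_det {A : M2 k} : IsUnit A ↔ A.det ≠ 0 := by
  rw [Matrix.isUnit_iff_isUnit_det, isUnit_iff_ne_zero]

/-- The Levi element. -/
noncomputable def lev (g h : M2 k) : M6 k := bdiag g h ((g⁻¹ * h).det • g)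

/-- A parametrisation of `U3`. -/
def uel (x y z w p q r : k) : M6 k :=
  Umat !![x, y; z, w] !![-w, y; z, -x] !![p, q; r, -(x * w - y * z) - p]

lemma one_mem_U3 : (1 : M6 k) ∈ U3 k := by
  refine ⟨0, 0, 0, by simp, by simp, ?_⟩
  apply bk_ext
  intro i j
  rw [Umat, bk_blk, bk_one]
  fin_cases i <;> fin_cases j <;> simp

lemma uel_mem_U3 (x y z w p q r : k) : uel x y z w p q r ∈ U3 k := by
  refine ⟨_, _, _, ?_, ?_, rfl⟩
  · ext a b; fin_cases a <;> fin_cases b <;>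
    simp [Jmat, Matrix.vecMul, dotProduct, Fin.sum_univ_two]
  · ext a b; fin_cases a <;> fin_cases b <;>
    simp [Jmat, Matrix.vecMul, dotProduct, Fin.sum_univ_two] <;> ring

lemma lev_one : lev (1 : M2 k) 1 = 1 := by
  apply bk_ext
  intro i j
  rw [lev, bdiag, bk_blk, bk_one]
  fin_cases i <;> fin_cases j <;> simp

lemma lev_mul_uel_mem {g h : M2 k} (hg : g.det ≠ 0) (hh : h.det ≠ 0) (x y z w p q r : k) :
    lev g h * uel x y z w p q r ∈ Q3 k :=
  Set.mul_mem_mul ⟨g, h, isUnit_iff_det.2 hg, isUnit_iff_det.2 hh, rfl⟩ (uel_mem_U3 _ _ _ _ _ _ _)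

lemma lev_mem {g h : M2 k} (hg : g.det ≠ 0) (hh : h.det ≠ 0) :
    lev g h ∈ Q3 k := by
  rw [← mul_one (lev g h)]
  exact Set.mul_mem_mul ⟨g, h, isUnit_iff_det.2 hg, isUnit_iff_det.2 hh, rfl⟩ one_mem_U3

lemma bk_lev (g h : M2 k) (i j : Fin 3) : bk (lev g h) i j =
    (![![g, 0, 0], ![0, h, 0], ![0, 0, (g⁻¹ * h).det • g]] : Fin 3 → Fin 3 → M2 k) i j :=
  bk_blk _ _ _

lemma bk_Umat (X Y Z : M2 k) (i j : Fin 3) : bk (Umat X Y Z) i j =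
    (![![1, X, Z], ![0, 1, Y], ![0, 0, 1]] : Fin 3 → Fin 3 → M2 k) i j :=
  bk_blk _ _ _

lemma lev_GSp {g h : M2 k} (hg : g.det ≠ 0) (hh : h.det ≠ 0) : lev g h ∈ GSp6 k := by
  refine GSp_of_rel h.det hh fun i j => ?_
  have e : g.det⁻¹ * h.det * g.det = h.det := by field_simp
  fin_cases i <;> fin_cases j <;>
    simp [bk_lev, bk_J3, J_conj, smul_smul, Matrix.det_nonsing_inv, e]

lemma U3_GSp {u : M6 k} (hu : u ∈ U3 k) : u ∈ GSp6 k := by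
  obtain ⟨X, Y, Z, h1, h2, rfl⟩ := hu
  have h1' : Jmat * Xᵀ + Y * Jmat = 0 := by
    have := congrArg Matrix.transpose h1
    simp only [Matrix.transpose_add, Matrix.transpose_mul, J_tr, Matrix.transpose_transpose,
      Matrix.transpose_zero, neg_mul, mul_neg] at this
    rw [← neg_add, neg_eq_zero] at this
    exact this
  refine GSp_of_rel 1 one_ne_zero fun i j => ?_
  fin_cases i <;> fin_cases j <;> simp [bk_Umat, bk_J3]
  · have : Jmat * Zᵀ + X * Jmat * Xᵀ + Z * Jmat = (Z * Jmat + Jmat * Zᵀ) + X * Jmat * Xᵀ := by abel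
    rw [this, h2]; simp
  · exact (add_comm _ _).trans h1
  · exact h1'

/-- Characterization of `Q3`. -/
lemma mem_Q3 {g : M6 k} : g ∈ Q3 k ↔ g ∈ GSp6 k ∧ bk g 1 0 = 0 ∧ bk g 2 0 = 0 ∧ bk g 2 1 = 0 := by
  constructor
  · rintro ⟨l, ⟨g, h, hg, hh, rfl⟩, u, hu, rfl⟩
    refine ⟨GSp_mul (lev_GSp (isUnit_iff_det.1 hg) (isUnit_iff_det.1 hh)) (U3_GSp hu), ?_⟩
    obtain ⟨X, Y, Z, h1, h2, rfl⟩ := hu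
    change bk (lev g h * _) _ _ = 0 ∧ bk (lev g h * _) _ _ = 0 ∧ bk (lev g h * _) _ _ = 0
    simp [bk_mul, bk_lev, bk_Umat]
  · rintro ⟨hG, h10, h20, h21⟩
    obtain ⟨l, hl, H⟩ := GSp_rel hG
    have H02 := H 0 2
    have H11 := H 1 1
    simp [h10, h20, h21, bk_J3] at H02 H11
    rw [J_conj] at H11
    have hdl : (bk g 1 1).det = l := by
      have := congrFun (congrFun H11 1) 0
      simpa [Jmat] using this
    have hh : (bk g 1 1).det ≠ 0 := hdl ▸ hl
    have hJd : (Jmat : M2 k).det = 1 := by simp [Jmat, Matrix.det_fin_two]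
    have hg : (bk g 0 0).det ≠ 0 := by
      intro h0
      have := congrArg Matrix.det H02
      simp [Matrix.det_smul, h0, hJd] at this
      exact hl (pow_eq_zero_iff two_ne_zero |>.1 this.symm)
    have hm : bk g 2 2 = ((bk g 0 0)⁻¹ * bk g 1 1).det • bk g 0 0 := by
      have e1 : bk g 0 0 * Jmat * (((bk g 0 0)⁻¹ * bk g 1 1).det • bk g 0 0)ᵀ = l • Jmat := by
        rw [Matrix.transpose_smul, Matrix.mul_smul, J_conj, smul_smul, Matrix.det_mul, hdl]
        congr 1
        simp [Matrix.det_nonsing_inv]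
        field_simp
      rw [← H02] at e1
      have hu : IsUnit (bk g 0 0 * Jmat) := by
        rw [isUnit_iff_det, Matrix.det_mul, hJd]; simpa using hg
      exact (Matrix.transpose_injective (hu.mul_left_cancel e1)).symm
    have hlu := isUnit_iff_det.2 hg
    have hlh := isUnit_iff_det.2 hh
    have gi := Matrix.mul_nonsing_inv _ (isUnit_iff_ne_zero.2 hg)
    have hi := Matrix.mul_nonsing_inv _ (isUnit_iff_ne_zero.2 hh)
    set X := (bk g 0 0)⁻¹ * bk g 0 1 with hX
    set Y := (bk g 1 1)⁻¹ * bk g 1 2 with hY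
    set Z := (bk g 0 0)⁻¹ * bk g 0 2 with hZ
    have hfac : g = lev (bk g 0 0) (bk g 1 1) * Umat X Y Z := by
      apply bk_ext
      intro i j
      fin_cases i <;> fin_cases j <;>
        simp [bk_mul, bk_lev, bk_Umat, h10, h20, h21, hX, hY, hZ, ← mul_assoc, gi, hi]
      simpa using hm
    have hUG : Umat X Y Z ∈ GSp6 k := by
      have hL := lev_GSp hg hh
      have : Umat X Y Z = (lev (bk g 0 0) (bk g 1 1))⁻¹ * g := by
        conv_rhs => rhs; rw [hfac]
        rw [← mul_assoc, Matrix.nonsing_inv_mul _ (GSp_det hL), one_mul]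
      rw [this]
      exact GSp_mul (GSp_inv hL) hG
    rw [hfac]
    refine Set.mul_mem_mul ⟨_, _, hlu, hlh, rfl⟩ ⟨X, Y, Z, ?_, ?_, rfl⟩
    · obtain ⟨l', hl', H'⟩ := GSp_rel hUG
      have := H' 0 1
      simp [bk_Umat, bk_J3] at this
      rw [← this]; abel
    · obtain ⟨l', hl', H'⟩ := GSp_rel hUG
      have := H' 0 0
      simp [bk_Umat, bk_J3] at this
      rw [eq_neg_iff_add_eq_zero, ← this]; abel

lemma Q3_GSp {g : M6 k} (hg : g ∈ Q3 k) : g ∈ GSp6 k := (mem_Q3.1 hg).1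

lemma Q3_mul {g h : M6 k} (hg : g ∈ Q3 k) (hh : h ∈ Q3 k) : g * h ∈ Q3 k := by
  rw [mem_Q3] at *
  obtain ⟨a, b, c, d⟩ := hg
  obtain ⟨a', b', c', d'⟩ := hh
  exact ⟨GSp_mul a a', by simp [bk_mul, *], by simp [bk_mul, *], by simp [bk_mul, *]⟩

lemma Q3_inv {g : M6 k} (hg : g ∈ Q3 k) : g⁻¹ ∈ Q3 k := by
  rw [mem_Q3] at *
  obtain ⟨a, b, c, d⟩ := hg
  refine ⟨GSp_inv a, ?_⟩
  obtain ⟨l, hl, e⟩ := mem_GSp.1 a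
  rw [GSp_inv_eq hl e]
  simp only [bk_smul]
  simp [bk_mul, bk_transpose, bk_J3, b, c, d]

/-- It is enough to look at the first block column. -/
lemma mem_Q3_of_col {g : M6 k} (hG : g ∈ GSp6 k) (h10 : bk g 1 0 = 0) (h20 : bk g 2 0 = 0) :
    g ∈ Q3 k := by
  refine mem_Q3.2 ⟨hG, h10, h20, ?_⟩
  obtain ⟨l, hl, H⟩ := GSp_rel hG
  have H11 := H 1 1
  have H12 := H 1 2
  simp [h10, h20, bk_J3] at H11 H12
  have hJd : (Jmat : M2 k).det = 1 := by simp [Jmat, Matrix.det_fin_two]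
  have hu : IsUnit (bk g 1 1 * Jmat) := by
    rw [isUnit_iff_det]
    intro h0
    have := congrArg Matrix.det H11
    rw [Matrix.det_mul, h0] at this
    simp [Matrix.det_smul, hJd] at this
    exact hl (pow_eq_zero_iff two_ne_zero |>.1 this.symm)
  have := hu.mul_left_cancel (H12.trans (mul_zero _).symm)
  simpa using this

/-- Main criterion for membership in a double coset. -/
lemma mem_dc {g s m q} (hG : g ∈ GSp6 k) (hs : s ∈ GSp6 k) (hq : q ∈ Q3 k)
    (h : ∀ j, bk g 0 j = m * bk (s * q) 0 j) : g ∈ setT (Q3 k) * {s} * Q3 k := by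
  have hsq := GSp_mul hs (Q3_GSp hq)
  have hi := Matrix.mul_nonsing_inv _ (GSp_det hsq)
  have hi' := Matrix.nonsing_inv_mul _ (GSp_det hsq)
  set t := g * (s * q)⁻¹ with ht
  have hrow : ∀ j, bk t 0 j = m * bk (1 : M6 k) 0 j := by
    intro j
    rw [← hi, ht, bk_mul, bk_mul (s * q), h, h, h]
    simp only [mul_add, mul_assoc]
  have htQ : tᵀ ∈ Q3 k := by
    apply mem_Q3_of_col (GSp_tr (GSp_mul hG (GSp_inv hsq)))
    · rw [bk_transpose, hrow]; simp [bk_one]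
    · rw [bk_transpose, hrow]; simp [bk_one]
  have : g = t * s * q := by
    rw [mul_assoc, ht, mul_assoc, hi', mul_one]
  rw [this]
  exact Set.mul_mem_mul (Set.mul_mem_mul ⟨_, htQ, by simp⟩ rfl) hq

/-- Moving inside a double coset. -/
lemma dc_move {g s p q : M6 k} (hp : p ∈ Q3 k) (hq : q ∈ Q3 k)
    (h : pᵀ * g * q ∈ setT (Q3 k) * {s} * Q3 k) : g ∈ setT (Q3 k) * {s} * Q3 k := by
  obtain ⟨_, ⟨_, ⟨p', hp', rfl⟩, s', hs', rfl⟩, q', hq', e⟩ := h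
  obtain rfl : s' = s := hs'
  have hqi := Matrix.mul_nonsing_inv _ (GSp_det (Q3_GSp hq))
  have hpi := Matrix.nonsing_inv_mul _ (GSp_det (GSp_tr (Q3_GSp hp)))
  have : g = (p' * p⁻¹)ᵀ * s' * (q' * q⁻¹) := by
    have : g = (pᵀ)⁻¹ * (pᵀ * g * q) * q⁻¹ := by
      rw [← mul_assoc, ← mul_assoc, hpi, one_mul, mul_assoc, hqi, mul_one]
    rw [this, ← e, Matrix.transpose_mul, Matrix.transpose_nonsing_inv]
    simp only [mul_assoc]
  rw [this]
  exact Set.mul_mem_mul (Set.mul_mem_mul ⟨_, Q3_mul hp' (Q3_inv hp), rfl⟩ rfl) (Q3_mul hq' (Q3_inv hq))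

lemma bk_b (i j : Fin 3) : bk (bmat : M6 k) i j =
    (![![!![1, 0; 0, 0], !![0, 0; 1, 0], 0], ![!![0, -1; 0, 0], 0, !![0, 0; 1, 0]],
      ![0, !![0, -1; 0, 0], !![0, 0; 0, 1]]] : Fin 3 → Fin 3 → M2 k) i j := by
  ext a b
  fin_cases i <;> fin_cases j <;> fin_cases a <;> fin_cases b <;> rfl

lemma bk_a (i j : Fin 3) : bk (amat : M6 k) i j =
    (![![Jmat, 0, 0], ![0, 1, 0], ![0, 0, Jmat]] : Fin 3 → Fin 3 → M2 k) i j := bk_blk _ _ _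

lemma bk_c (i j : Fin 3) : bk (cmat : M6 k) i j =
    (![![1, 0, 0], ![0, Jmat, 0], ![0, 0, 1]] : Fin 3 → Fin 3 → M2 k) i j := bk_blk _ _ _

lemma a_GSp : (amat : M6 k) ∈ GSp6 k := by
  refine GSp_of_rel 1 one_ne_zero fun i j => ?_
  fin_cases i <;> fin_cases j <;> simp [bk_a, bk_J3, J_tr, J_sq, mul_assoc]

lemma c_GSp : (cmat : M6 k) ∈ GSp6 k := by
  refine GSp_of_rel 1 one_ne_zero fun i j => ?_
  fin_cases i <;> fin_cases j <;> simp [bk_c, bk_J3, J_tr, J_sq, mul_assoc]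

lemma b_GSp : (bmat : M6 k) ∈ GSp6 k := by
  refine GSp_of_rel 1 one_ne_zero fun i j => ?_
  have t : ∀ a b c d : k, (!![a, b; c, d] : M2 k)ᵀ = !![a, c; b, d] := fun a b c d => by
    ext i j; fin_cases i <;> fin_cases j <;> rfl
  fin_cases i <;> fin_cases j <;> simp [bk_b, bk_J3, Jmat, t]
  all_goals ext a b; fin_cases a <;> fin_cases b <;> rfl

lemma one_GSp : (1 : M6 k) ∈ GSp6 k := by
  rw [← lev_one]; exact lev_GSp (by simp) (by simp)

/-- `b c b`. -/
def s2 : M6 k := bmat * cmat * bmat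
/-- `b a c b`. -/
def s3 : M6 k := bmat * amat * cmat * bmat
/-- `b c a b a c b`. -/
def s4 : M6 k := bmat * cmat * amat * bmat * amat * cmat * bmat

lemma s2_GSp : (s2 : M6 k) ∈ GSp6 k := GSp_mul (GSp_mul b_GSp c_GSp) b_GSp
lemma s3_GSp : (s3 : M6 k) ∈ GSp6 k := GSp_mul (GSp_mul (GSp_mul b_GSp a_GSp) c_GSp) b_GSp
lemma s4_GSp : (s4 : M6 k) ∈ GSp6 k :=
  GSp_mul (GSp_mul (GSp_mul (GSp_mul (GSp_mul (GSp_mul b_GSp c_GSp) a_GSp) b_GSp) a_GSp) c_GSp) b_GSp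

lemma s2_row (j : Fin 3) : bk (s2 : M6 k) 0 j =
    (![!![1, 0; 0, 0], 0, !![0, 0; -1, 0]] : Fin 3 → M2 k) j := by
  fin_cases j <;> simp [s2, bk_mul, bk_b, bk_c, Jmat]
  all_goals first | (ext a b; fin_cases a <;> fin_cases b <;> rfl) | (ext a; fin_cases a <;> simp)

lemma s3_row (j : Fin 3) : bk (s3 : M6 k) 0 j =
    (![0, !![-1, 0; 0, 0], !![0, 0; -1, 0]] : Fin 3 → M2 k) j := by
  fin_cases j <;> simp [s3, bk_mul, bk_b, bk_c, bk_a, Jmat]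
  all_goals first | (ext a b; fin_cases a <;> fin_cases b <;> rfl) | (ext a; fin_cases a <;> simp)

lemma s4_row (j : Fin 3) : bk (s4 : M6 k) 0 j =
    (![0, 0, 1] : Fin 3 → M2 k) j := by
  fin_cases j <;> simp [s4, bk_mul, bk_b, bk_c, bk_a, Jmat]
  all_goals ext a b; fin_cases a <;> fin_cases b <;> simp

/-- `g` lies in one of the double cosets. -/
def Good (g : M6 k) : Prop := ∃ s ∈ SigmaSet k, g ∈ setT (Q3 k) * {s} * Q3 k

lemma Good_move {g p q : M6 k} (hp : p ∈ Q3 k) (hq : q ∈ Q3 k) (h : Good (pᵀ * g * q)) : Good g := by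
  obtain ⟨s, hs, h⟩ := h
  exact ⟨s, hs, dc_move hp hq h⟩

lemma good1 {g q m} (hG : g ∈ GSp6 k) (hq : q ∈ Q3 k)
    (h : ∀ j, bk g 0 j = m * bk (1 * q) 0 j) : Good g :=
  ⟨1, by simp [SigmaSet], mem_dc hG one_GSp hq h⟩
lemma goodb {g q m} (hG : g ∈ GSp6 k) (hq : q ∈ Q3 k)
    (h : ∀ j, bk g 0 j = m * bk (bmat * q) 0 j) : Good g :=
  ⟨bmat, by simp [SigmaSet], mem_dc hG b_GSp hq h⟩
lemma good2 {g q m} (hG : g ∈ GSp6 k) (hq : q ∈ Q3 k)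
    (h : ∀ j, bk g 0 j = m * bk (s2 * q) 0 j) : Good g :=
  ⟨s2, by simp [SigmaSet, s2], mem_dc hG s2_GSp hq h⟩
lemma good3 {g q m} (hG : g ∈ GSp6 k) (hq : q ∈ Q3 k)
    (h : ∀ j, bk g 0 j = m * bk (s3 * q) 0 j) : Good g :=
  ⟨s3, by simp [SigmaSet, s3], mem_dc hG s3_GSp hq h⟩
lemma good4 {g q m} (hG : g ∈ GSp6 k) (hq : q ∈ Q3 k)
    (h : ∀ j, bk g 0 j = m * bk (s4 * q) 0 j) : Good g :=
  ⟨s4, by simp [SigmaSet, s4], mem_dc hG s4_GSp hq h⟩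

lemma row_ne {g : M6 k} (hG : g ∈ GSp6 k) (h : ∀ j a, bk g 0 j 1 a = 0) : False := by
  obtain ⟨l, hl, H⟩ := GSp_rel hG
  have := congrFun (congrFun (H 0 2) 1) 0
  simp [bk_J3, Jmat, Matrix.mul_apply, Fin.sum_univ_two, h] at this
  exact hl this.symm

lemma iso_eq {g : M6 k} (hG : g ∈ GSp6 k) {a b c d b1 b2 b3 b4 c1 c2 c3 c4 : k}
    (hA : bk g 0 0 = !![a, b; c, d]) (hB : bk g 0 1 = !![b1, b2; b3, b4])
    (hC : bk g 0 2 = !![c1, c2; c3, c4]) :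
    (b * c3 - a * c4) + (b2 * b3 - b1 * b4) + (c2 * c - c1 * d) = 0 := by
  obtain ⟨l, hl, H⟩ := GSp_rel hG
  have := congrFun (congrFun (H 0 0) 0) 1
  rw [hA, hB, hC] at this
  simp [bk_J3, Jmat, Matrix.vecMul, dotProduct, Fin.sum_univ_two] at this
  linear_combination this

lemma case_r2 {g : M6 k} (hG : g ∈ GSp6 k) (hd : (bk g 0 0).det ≠ 0) : Good g := by
  have hu := Matrix.mul_nonsing_inv _ (isUnit_iff_ne_zero.2 hd)
  -- normalise the first block to `1`
  have hm : ((bk g 0 0)⁻¹ᵀ).det ≠ 0 := by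
    rw [Matrix.det_transpose, Matrix.det_nonsing_inv]; simpa using hd
  have hp := lev_mem hm (h := 1) (by simp)
  refine Good_move hp (lev_mem (g := 1) (h := 1) (by simp) (by simp)) ?_
  rw [lev_one, mul_one]
  have hG' := GSp_mul (GSp_tr (Q3_GSp hp)) hG
  have h00 : bk ((lev (bk g 0 0)⁻¹ᵀ 1)ᵀ * g) 0 0 = 1 := by
    simp [bk_mul, bk_transpose, bk_lev, Matrix.nonsing_inv_mul _ (isUnit_iff_ne_zero.2 hd)]
  generalize (lev (bk g 0 0)⁻¹ᵀ 1)ᵀ * g = g' at hG' h00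
  have hB := Matrix.eta_fin_two (bk g' 0 1)
  have hC := Matrix.eta_fin_two (bk g' 0 2)
  have hI := iso_eq hG' (h00.trans Matrix.one_fin_two) hB hC
  refine good1 (m := 1) hG' (q := lev 1 1 * uel (bk g' 0 1 0 0) (bk g' 0 1 0 1) (bk g' 0 1 1 0)
    (bk g' 0 1 1 1) (bk g' 0 2 0 0) (bk g' 0 2 0 1) (bk g' 0 2 1 0))
    (lev_mul_uel_mem (by simp) (by simp) _ _ _ _ _ _ _) ?_
  rw [lev_one]
  intro j
  fin_cases j
  · simp [uel, bk_Umat, h00]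
  · simp [uel, bk_Umat]; exact hB
  · simp [uel, bk_Umat]
    rw [hC]
    ext a b
    fin_cases a <;> fin_cases b <;> simp
    linear_combination -hI

lemma case_r1 {g : M6 k} (hG : g ∈ GSp6 k) (hA : bk g 0 0 = !![1, 0; 0, 0]) : Good g := by
  have hB := Matrix.eta_fin_two (bk g 0 1)
  have hC := Matrix.eta_fin_two (bk g 0 2)
  generalize bk g 0 1 0 0 = b1, bk g 0 1 0 1 = b2, bk g 0 1 1 0 = b3, bk g 0 1 1 1 = b4,
    bk g 0 2 0 0 = c1, bk g 0 2 0 1 = c2, bk g 0 2 1 0 = c3, bk g 0 2 1 1 = c4 at hB hC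
  have hI := iso_eq hG hA hB hC
  by_cases h3 : b3 = 0
  · by_cases h4 : b4 = 0
    · have hc4 : c4 = 0 := by subst h3 h4; linear_combination -hI
      subst h3 h4 hc4
      have hc3 : c3 ≠ 0 := by
        rintro rfl
        refine row_ne hG fun j a => ?_
        fin_cases j <;> fin_cases a <;> simp [hA, hB, hC]
      refine good2 (m := 1) hG (q := lev 1 !![1, 0; 0, -c3⁻¹⁻¹] * uel b1 b2 0 0 c1 c2 0)
        (lev_mul_uel_mem (by simp) (by simpa using hc3) _ _ _ _ _ _ _) ?_
      intro j
      fin_cases j <;>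
        simp [bk_mul, s2_row, bk_lev, uel, bk_Umat, hA, hB, hC]
    · subst h3
      refine goodb (m := 1) hG (q := lev 1 !![0, b4; 1, 0] * uel b1 b2 (c3 / b4) 0 c1 c2 0)
        (lev_mul_uel_mem (by simp) (by simpa using h4) _ _ _ _ _ _ _) ?_
      intro j
      fin_cases j <;>
        simp [bk_mul, bk_b, bk_lev, uel, bk_Umat, hA, hB, hC]
      refine ⟨?_, ?_⟩
      · field_simp
      · linear_combination -hI
  · refine goodb (m := 1) hG (q := lev 1 !![b3, b4; 0, 1] * uel b1 b2 0 (-c3 / b3) c1 c2 0)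
        (lev_mul_uel_mem (by simp) (by simpa using h3) _ _ _ _ _ _ _) ?_
    intro j
    fin_cases j <;>
      simp [bk_mul, bk_b, bk_lev, uel, bk_Umat, hA, hB, hC]
    refine ⟨?_, ?_⟩
    · field_simp
    · linear_combination -hI

lemma case_r0 {g : M6 k} (hG : g ∈ GSp6 k) (hA : bk g 0 0 = 0) (hB : bk g 0 1 = !![1, 0; 0, 0]) :
    Good g := by
  have hC := Matrix.eta_fin_two (bk g 0 2)
  generalize bk g 0 2 0 0 = c1, bk g 0 2 0 1 = c2, bk g 0 2 1 0 = c3, bk g 0 2 1 1 = c4 at hC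
  by_cases h3 : c3 = 0
  · by_cases h4 : c4 = 0
    · exfalso
      subst h3 h4
      refine row_ne hG fun j a => ?_
      fin_cases j <;> fin_cases a <;> simp [hA, hB, hC]
    · subst h3
      refine good3 (m := -1) hG (q := lev !![0, c4; 1, 0] !![1, 0; 0, -c4] * uel 0 c2 0 (-c1) 0 0 0)
        (lev_mul_uel_mem (by simpa using h4) (by simpa using h4) _ _ _ _ _ _ _) ?_
      intro j
      fin_cases j <;>
        simp [bk_mul, s3_row, bk_lev, uel, bk_Umat, hA, hB, hC, Matrix.det_nonsing_inv, h4]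
  · refine good3 (m := -1) hG (q := lev !![c3, c4; 0, 1] !![1, 0; 0, c3] * uel 0 c2 0 (-c1) 0 0 0)
        (lev_mul_uel_mem (by simpa using h3) (by simpa using h3) _ _ _ _ _ _ _) ?_
    intro j
    fin_cases j <;>
      simp [bk_mul, s3_row, bk_lev, uel, bk_Umat, hA, hB, hC, Matrix.det_nonsing_inv, h3]

lemma case_00 {g : M6 k} (hG : g ∈ GSp6 k) (hA : bk g 0 0 = 0) (hB : bk g 0 1 = 0) : Good g := by
  refine good4 (m := bk g 0 2) hG (q := lev 1 1) (lev_mem (by simp) (by simp)) ?_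
  rw [lev_one, mul_one]
  intro j
  fin_cases j <;> simp [s4_row, hA, hB]

lemma norm0 {A : M2 k} (h0 : A 0 0 ≠ 0) (hd : A.det = 0) :
    ∃ m n : M2 k, m.det ≠ 0 ∧ n.det ≠ 0 ∧ m * A * n = !![1, 0; 0, 0] := by
  rw [Matrix.det_fin_two] at hd
  refine ⟨!![(A 0 0)⁻¹, 0; -A 1 0 / A 0 0, 1], !![1, -A 0 1 / A 0 0; 0, 1], by simpa using h0,
    by simp, ?_⟩
  rw [Matrix.eta_fin_two A]
  generalize A 0 0 = a, A 0 1 = b, A 1 0 = c, A 1 1 = d at h0 hd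
  ext i j
  fin_cases i <;> fin_cases j <;> simp <;> field_simp <;> first | linear_combination hd | linear_combination -hd | ring

lemma normE {A : M2 k} (h0 : A ≠ 0) (hd : A.det = 0) :
    ∃ m n : M2 k, m.det ≠ 0 ∧ n.det ≠ 0 ∧ m * A * n = !![1, 0; 0, 0] := by
  have key : ∀ u v : M2 k, u.det ≠ 0 → v.det ≠ 0 → (u * A * v) 0 0 ≠ 0 →
      ∃ m n : M2 k, m.det ≠ 0 ∧ n.det ≠ 0 ∧ m * A * n = !![1, 0; 0, 0] := by
    intro u v hu hv h
    obtain ⟨m, n, hm, hn, e⟩ := norm0 h (by simp [Matrix.det_mul, hd])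
    exact ⟨m * u, v * n, by simp [hm, hu], by simp [hn, hv], by rw [← e]; simp only [mul_assoc]⟩
  by_contra hc
  have h1 : ∀ u v : M2 k, u.det ≠ 0 → v.det ≠ 0 → (u * A * v) 0 0 = 0 := by
    intro u v hu hv
    by_contra h
    exact hc (key u v hu hv h)
  have h00 := h1 1 1 (by simp) (by simp)
  have h10 := h1 !![0, 1; 1, 0] 1 (by simp) (by simp)
  have h01 := h1 1 !![0, 1; 1, 0] (by simp) (by simp)
  have h11 := h1 !![0, 1; 1, 0] !![0, 1; 1, 0] (by simp) (by simp)
  simp [Matrix.mul_apply, Matrix.vecMul, dotProduct, Fin.sum_univ_two] at h00 h10 h01 h11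
  apply h0
  ext i j
  fin_cases i <;> fin_cases j <;> simp [*]

lemma exists_good {g : M6 k} (hG : g ∈ GSp6 k) : Good g := by
  by_cases hd : (bk g 0 0).det = 0
  swap
  · exact case_r2 hG hd
  by_cases h0 : bk g 0 0 = 0
  · by_cases h1 : bk g 0 1 = 0
    · exact case_00 hG h0 h1
    have hI := iso_eq hG (Matrix.eta_fin_two _) (Matrix.eta_fin_two _) (Matrix.eta_fin_two _)
    have hBd : (bk g 0 1).det = 0 := by
      rw [Matrix.det_fin_two]
      simp [h0] at hI
      linear_combination -hI
    obtain ⟨m, n, hm, hn, e⟩ := normE h1 hBd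
    have hp : lev mᵀ 1 ∈ Q3 k := lev_mem (by simpa using hm) (by simp)
    have hq : lev 1 n ∈ Q3 k := lev_mem (by simp) hn
    refine Good_move hp hq ?_
    refine case_r0 (GSp_mul (GSp_mul (GSp_tr (Q3_GSp hp)) hG) (Q3_GSp hq)) ?_ ?_
    · simp [bk_mul, bk_transpose, bk_lev, h0]
    · rw [← e]; simp [bk_mul, bk_transpose, bk_lev]
  · obtain ⟨m, n, hm, hn, e⟩ := normE h0 hd
    have hp : lev mᵀ 1 ∈ Q3 k := lev_mem (by simpa using hm) (by simp)
    have hq : lev n 1 ∈ Q3 k := lev_mem hn (by simp)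
    refine Good_move hp hq ?_
    refine case_r1 (GSp_mul (GSp_mul (GSp_tr (Q3_GSp hp)) hG) (Q3_GSp hq)) ?_
    rw [← e]; simp [bk_mul, bk_transpose, bk_lev]

/-- The invariants separating the double cosets. -/
def D1 (g : M6 k) : Prop := bk g 0 0 = 0
/-- Second invariant. -/
def D2 (g : M6 k) : Prop := (bk g 0 0).det = 0
/-- Third invariant. -/
def D3 (g : M6 k) : Prop := bk g 0 0 = 0 ∧ bk g 0 1 = 0
/-- Fourth invariant. -/
def D4 (g : M6 k) : Prop := ∃ N : M2 k, N ≠ 0 ∧ N * bk g 0 0 = 0 ∧ N * bk g 0 1 = 0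

lemma D_imp {p s q : M6 k} (hp : p ∈ Q3 k) (hq : q ∈ Q3 k) :
    (D1 s → D1 (pᵀ * s * q)) ∧ (D2 s → D2 (pᵀ * s * q)) ∧ (D3 s → D3 (pᵀ * s * q)) ∧
    (D4 s → D4 (pᵀ * s * q)) := by
  have hp0 : IsUnit (bk p 0 0) := by
    obtain ⟨_, ⟨g, h, hg, hh, rfl⟩, _, ⟨X, Y, Z, h1, h2, rfl⟩, rfl⟩ := hp
    change IsUnit (bk (lev g h * _) _ _)
    simpa [bk_mul, bk_lev, bk_Umat] using hg
  have hpd : IsUnit ((bk p 0 0)ᵀ).det := by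
    rw [Matrix.det_transpose]; exact (Matrix.isUnit_iff_isUnit_det _).1 hp0
  obtain ⟨-, p1, p2, p3⟩ := mem_Q3.1 hp
  obtain ⟨-, q1, q2, q3⟩ := mem_Q3.1 hq
  have e0 : bk (pᵀ * s * q) 0 0 = (bk p 0 0)ᵀ * (bk s 0 0 * bk q 0 0) := by
    simp [bk_mul, bk_transpose, p1, p2, q1, q2, mul_assoc]
  have e1 : bk (pᵀ * s * q) 0 1 = (bk p 0 0)ᵀ * (bk s 0 0 * bk q 0 1 + bk s 0 1 * bk q 1 1) := by
    simp [bk_mul, bk_transpose, p1, p2, q3, mul_assoc, mul_add]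
  refine ⟨fun h => ?_, fun h => ?_, fun h => ?_, fun h => ?_⟩
  · unfold D1 at *; simp [e0, h]
  · unfold D2 at *; simp [e0, h]
  · unfold D3 at *; simp [e0, e1, h]
  · obtain ⟨N, hN, n0, n1⟩ := h
    have hc : N * ((bk p 0 0)ᵀ)⁻¹ * (bk p 0 0)ᵀ = N := by
      rw [mul_assoc, Matrix.nonsing_inv_mul _ hpd, mul_one]
    refine ⟨N * ((bk p 0 0)ᵀ)⁻¹, ?_, ?_, ?_⟩
    · intro h; rw [h, zero_mul] at hc; exact hN hc.symm
    · rw [e0, ← mul_assoc, hc, ← mul_assoc, n0, zero_mul]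
    · rw [e1, ← mul_assoc, hc, mul_add, ← mul_assoc, ← mul_assoc, n0, n1, zero_mul, zero_mul, add_zero]

lemma D_iff {g s : M6 k} (h : g ∈ setT (Q3 k) * {s} * Q3 k) :
    (D1 g ↔ D1 s) ∧ (D2 g ↔ D2 s) ∧ (D3 g ↔ D3 s) ∧ (D4 g ↔ D4 s) := by
  obtain ⟨_, ⟨_, ⟨p, hp, rfl⟩, s', hs', rfl⟩, q, hq, rfl⟩ := h
  obtain rfl : s' = s := hs'
  have hqi := Matrix.mul_nonsing_inv _ (GSp_det (Q3_GSp hq))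
  have hpi := Matrix.nonsing_inv_mul _ (GSp_det (GSp_tr (Q3_GSp hp)))
  have e : s' = (p⁻¹)ᵀ * (pᵀ * s' * q) * q⁻¹ := by
    rw [Matrix.transpose_nonsing_inv, ← mul_assoc, ← mul_assoc, hpi, one_mul, mul_assoc, hqi, mul_one]
  have A := D_imp (s := s') hp hq
  have B := D_imp (s := pᵀ * s' * q) (Q3_inv hp) (Q3_inv hq)
  rw [← e] at B
  exact ⟨⟨B.1, A.1⟩, ⟨B.2.1, A.2.1⟩, ⟨B.2.2.1, A.2.2.1⟩, ⟨B.2.2.2, A.2.2.2⟩⟩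

lemma E_ne : (!![1, 0; 0, 0] : M2 k) ≠ 0 := by
  intro h; have := congrFun (congrFun h 0) 0; simp at this

lemma D_one : ¬ D2 (1 : M6 k) := by simp [D2, bk_one]
lemma D_b : D2 (bmat : M6 k) ∧ ¬ D1 (bmat : M6 k) ∧ ¬ D4 (bmat : M6 k) := by
  refine ⟨by simp [D2, bk_b], by simpa [D1, bk_b] using E_ne, ?_⟩
  rintro ⟨N, hN, h0, h1⟩
  apply hN
  simp only [bk_b] at h0 h1
  have a0 := fun i => congrFun (congrFun h0 i) 0
  have a1 := fun i => congrFun (congrFun h1 i) 0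
  simp [Matrix.mul_apply, Fin.sum_univ_two] at a0 a1
  ext i j
  fin_cases i <;> fin_cases j <;> simp [a0, a1]
lemma D_s2 : D2 (s2 : M6 k) ∧ ¬ D1 (s2 : M6 k) ∧ D4 (s2 : M6 k) := by
  refine ⟨by simp [D2, s2_row], by simpa [D1, s2_row] using E_ne, !![0, 1; 0, 0], ?_, ?_, ?_⟩
  · intro h; have := congrFun (congrFun h 0) 1; simp at this
  · ext i j; fin_cases i <;> fin_cases j <;> simp [s2_row]
  · simp [s2_row]
lemma D_s3 : D2 (s3 : M6 k) ∧ D1 (s3 : M6 k) ∧ ¬ D3 (s3 : M6 k) := by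
  refine ⟨by simp [D2, s3_row], by simp [D1, s3_row], ?_⟩
  rintro ⟨-, h⟩
  have := congrFun (congrFun h 0) 0
  simp [s3_row] at this
lemma D_s4 : D2 (s4 : M6 k) ∧ D1 (s4 : M6 k) ∧ D3 (s4 : M6 k) := by
  refine ⟨by simp [D2, s4_row], by simp [D1, s4_row], by simp [D3, s4_row]⟩

lemma sigma_unique {s t g : M6 k} (hs : s ∈ SigmaSet k) (ht : t ∈ SigmaSet k)
    (h1 : g ∈ setT (Q3 k) * {s} * Q3 k) (h2 : g ∈ setT (Q3 k) * {t} * Q3 k) : s = t := by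
  have A := D_iff h1
  have B := D_iff h2
  have e0 := D_one (k := k)
  have e1 := D_b (k := k)
  have e2 := D_s2 (k := k)
  have e3 := D_s3 (k := k)
  have e4 := D_s4 (k := k)
  change s = 1 ∨ s = bmat ∨ s = s2 ∨ s = s3 ∨ s = s4 at hs
  change t = 1 ∨ t = bmat ∨ t = s2 ∨ t = s3 ∨ t = s4 at ht
  clear h1 h2
  rcases hs with rfl | rfl | rfl | rfl | rfl <;> rcases ht with rfl | rfl | rfl | rfl | rfl <;>
    first | rfl | (exfalso; grind only)

/-- Every element of `GSp6(k)` lies in the double coset `Q3ᵀ·σ·Q3` for exactly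
one `σ ∈ Σ = {1, b, bcb, bacb, bcabacb}`: `GSp6(k)` is the disjoint union of these double
cosets. -/
theorem gsp6_double_coset_decomposition (k : Type*) [Field k] :
    ∀ g ∈ GSp6 k, ∃! σ : M6 k, σ ∈ SigmaSet k ∧ g ∈ setT (Q3 k) * {σ} * Q3 k := by
  intro g hg
  obtain ⟨s, hs, h⟩ := exists_good hg
  exact ⟨s, ⟨hs, h⟩, fun t ht => sigma_unique ht.1 hs ht.2 h⟩
end

section
/- For each σ ∈ Σ = {1, b, b·c·b, b·a·c·b, b·c·a·b·a·c·b}, the double coset R = Q3ᵀ·σ·Q3 is stable under transposition: Rᵀ = R, i.e. g ∈ R if and only if gᵀ ∈ R. -/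
open Matrix Pointwise

variable {k : Type*} [Field k]

lemma bdiag_eq (g h m : M2 k) : bdiag g h m =
    !![g 0 0, g 0 1, 0, 0, 0, 0; g 1 0, g 1 1, 0, 0, 0, 0;
      0, 0, h 0 0, h 0 1, 0, 0; 0, 0, h 1 0, h 1 1, 0, 0;
      0, 0, 0, 0, m 0 0, m 0 1; 0, 0, 0, 0, m 1 0, m 1 1] := by
  ext i j
  fin_cases i <;> fin_cases j <;> rfl

lemma bdiag_mul (g h m g' h' m' : M2 k) :
    bdiag g h m * bdiag g' h' m' = bdiag (g * g') (h * h') (m * m') := by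
  simp [bdiag_eq, Matrix.mul_apply, Fin.sum_univ_two]

lemma L3_mul {x y : M6 k} (hx : x ∈ L3 k) (hy : y ∈ L3 k) : x * y ∈ L3 k := by
  obtain ⟨g, h, hg, hh, rfl⟩ := hx
  obtain ⟨g', h', hg', hh', rfl⟩ := hy
  refine ⟨g * g', h * h', hg.mul hg', hh.mul hh', ?_⟩
  rw [bdiag_mul, smul_mul_smul_comm]
  congr 2
  simp only [Matrix.det_mul, Matrix.mul_inv_rev]
  ring

lemma stable_of {σ d : M6 k} (hd : d ∈ L3 k) (h : σᵀ = σ * d) :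
    setT (setT (Q3 k) * {σ} * Q3 k) = setT (Q3 k) * {σ} * Q3 k := by
  have key : ∀ x ∈ setT (Q3 k) * {σ} * Q3 k, xᵀ ∈ setT (Q3 k) * {σ} * Q3 k := by
    rintro _ ⟨_, ⟨_, ⟨q, hq, rfl⟩, s, hs, rfl⟩, r, hr, rfl⟩
    rw [Set.mem_singleton_iff] at hs
    subst hs
    obtain ⟨l, hl, u, hu, rfl⟩ := hq
    refine ⟨rᵀ * s, ⟨rᵀ, ⟨r, hr, rfl⟩, s, rfl, rfl⟩, (d * l) * u,
      ⟨d * l, L3_mul hd hl, u, hu, rfl⟩, ?_⟩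
    simp [Matrix.transpose_mul, h, Matrix.mul_assoc]
  apply Set.Subset.antisymm
  · rintro _ ⟨x, hx, rfl⟩
    exact key x hx
  · intro x hx
    exact ⟨xᵀ, key x hx, Matrix.transpose_transpose x⟩

lemma diag_mem (p q r s : k) (hp : p * p = 1) (hq : q * q = 1) (hr : r * r = 1)
    (hs : s * s = 1) :
    bdiag !![p, 0; 0, q] !![r, 0; 0, s] !![r * s * q, 0; 0, r * s * p] ∈ L3 k := by
  have e : !![p, 0; 0, q]⁻¹ = !![p, 0; 0, q] := by
    apply Matrix.inv_eq_right_inv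
    simp [hp, hq, Matrix.one_fin_two]
  refine ⟨!![p, 0; 0, q], !![r, 0; 0, s], ?_, ?_, ?_⟩
  · exact IsUnit.of_mul_eq_one _ (show _ * !![p, 0; 0, q] = 1 by
      simp [hp, hq, Matrix.one_fin_two])
  · exact IsUnit.of_mul_eq_one _ (show _ * !![r, 0; 0, s] = 1 by
      simp [hr, hs, Matrix.one_fin_two])
  · rw [e]
    congr 1
    simp only [Matrix.det_mul, Matrix.det_fin_two_of, Matrix.smul_of]
    ext i j
    fin_cases i <;> fin_cases j <;> simp
    · linear_combination (-q * r * s) * hp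
    · linear_combination (-p * r * s) * hq

lemma a_eq : (amat : M6 k) = !![0,-1,0,0,0,0; 1,0,0,0,0,0; 0,0,1,0,0,0; 0,0,0,1,0,0; 0,0,0,0,0,-1; 0,0,0,0,1,0] := by
  simp [amat, bdiag_eq, Jmat]

lemma c_eq : (cmat : M6 k) = !![1,0,0,0,0,0; 0,1,0,0,0,0; 0,0,0,-1,0,0; 0,0,1,0,0,0; 0,0,0,0,1,0; 0,0,0,0,0,1] := by
  simp [cmat, bdiag_eq, Jmat]

lemma d_eq (p q r s t u : k) : bdiag !![p, 0; 0, q] !![r, 0; 0, s] !![t, 0; 0, u] =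
    !![p,0,0,0,0,0; 0,q,0,0,0,0; 0,0,r,0,0,0; 0,0,0,s,0,0; 0,0,0,0,t,0; 0,0,0,0,0,u] := by
  simp [bdiag_eq]

lemma bcb_eq : (bmat * cmat * bmat : M6 k) =
    !![1,0,0,0,0,0; 0,0,0,0,-1,0; 0,0,-1,0,0,0; 0,0,0,-1,0,0; 0,1,0,0,0,0; 0,0,0,0,0,1] := by
  rw [c_eq]; simp [bmat]

lemma bacb_eq : (bmat * amat * cmat * bmat : M6 k) =
    !![0,0,-1,0,0,0; 0,0,0,0,-1,0; -1,0,0,0,0,0; 0,0,0,0,0,-1; 0,1,0,0,0,0; 0,0,0,-1,0,0] := by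
  rw [a_eq, c_eq]; simp [bmat]

lemma bcabacb_eq : (bmat * cmat * amat * bmat * amat * cmat * bmat : M6 k) =
    !![0,0,0,0,1,0; 0,0,0,0,0,1; 0,0,1,0,0,0; 0,0,0,1,0,0; 1,0,0,0,0,0; 0,1,0,0,0,0] := by
  rw [a_eq, c_eq]; simp [bmat]

lemma transpose_explicit (x00 x01 x02 x03 x04 x05
    x10 x11 x12 x13 x14 x15
    x20 x21 x22 x23 x24 x25
    x30 x31 x32 x33 x34 x35
    x40 x41 x42 x43 x44 x45
    x50 x51 x52 x53 x54 x55 : k) :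
    (!![x00, x01, x02, x03, x04, x05;
      x10, x11, x12, x13, x14, x15;
      x20, x21, x22, x23, x24, x25;
      x30, x31, x32, x33, x34, x35;
      x40, x41, x42, x43, x44, x45;
      x50, x51, x52, x53, x54, x55])ᵀ =
    !![x00, x10, x20, x30, x40, x50;
      x01, x11, x21, x31, x41, x51;
      x02, x12, x22, x32, x42, x52;
      x03, x13, x23, x33, x43, x53;
      x04, x14, x24, x34, x44, x54;
      x05, x15, x25, x35, x45, x55] := by
  simp [← Matrix.ext_iff, Fin.forall_fin_succ]

/-- For each `σ ∈ Σ`, the double coset `R = Q3ᵀ·σ·Q3` is stable under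
transposition: `Rᵀ = R`. -/
theorem double_coset_transpose_stable (k : Type*) [Field k] :
    ∀ σ ∈ SigmaSet k, setT (setT (Q3 k) * {σ} * Q3 k) = setT (Q3 k) * {σ} * Q3 k := by
  intro σ hσ
  simp only [SigmaSet, Set.mem_insert_iff, Set.mem_singleton_iff] at hσ
  rcases hσ with rfl | rfl | rfl | rfl | rfl
  · refine stable_of (d := 1) ⟨1, 1, isUnit_one, isUnit_one, ?_⟩ (by simp)
    simp [bdiag_eq]
    ext i j
    fin_cases i <;> fin_cases j <;> simp
  · refine stable_of (diag_mem 1 (-1) (-1) (-1) (by simp) (by simp) (by simp) (by simp)) ?_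
    rw [d_eq]
    rw [bmat, transpose_explicit]
    simp
  · refine stable_of (diag_mem 1 (-1) 1 1 (by simp) (by simp) (by simp) (by simp)) ?_
    rw [d_eq]
    rw [bcb_eq]
    rw [transpose_explicit]
    simp
  · refine stable_of (diag_mem 1 (-1) 1 1 (by simp) (by simp) (by simp) (by simp)) ?_
    rw [d_eq]
    rw [bacb_eq]
    rw [transpose_explicit]
    simp
  · refine stable_of (diag_mem 1 1 1 1 (by simp) (by simp) (by simp) (by simp)) ?_
    rw [d_eq]
    rw [bcabacb_eq]
    rw [transpose_explicit]
    simp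
end

section
/- Let k be a field and ψ : (k,+) → ℂˣ a nontrivial group homomorphism. Then for g, h ∈ GL2(k), one has ψ(tr(g·X·h⁻¹)) = ψ(tr(X)) for all X ∈ M2(k) if and only if g = h. (Equivalently, the centralizer in L3 ≅ GL2 × GL2 of the character X ↦ ψ(−tr X) of U3/Z3 ≅ M2(k), for the action (g,h)·X = g·X·h⁻¹, is exactly the diagonal Δ(GL2).) -/
open Matrix

/-- Let `k` be a field and `ψ : (k,+) → ℂˣ` a nontrivial group homomorphism.
For invertible `g, h ∈ GL2(k)`, one has `ψ(tr(g·X·h⁻¹)) = ψ(tr(X))` for all `X ∈ M2(k)` if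
and only if `g = h`. -/
theorem character_centralizer_diagonal {k : Type*} [Field k]
    (ψ : k → ℂˣ) (hψ : ∀ x y : k, ψ (x + y) = ψ x * ψ y) (hnt : ∃ x : k, ψ x ≠ 1)
    (g h : Matrix (Fin 2) (Fin 2) k) (hg : IsUnit g) (hh : IsUnit h) :
    (∀ X : Matrix (Fin 2) (Fin 2) k, ψ (g * X * h⁻¹).trace = ψ X.trace) ↔ g = h := by
  have hdet : IsUnit h.det := (Matrix.isUnit_iff_isUnit_det h).1 hh
  constructor
  · intro H
    obtain ⟨x, hx⟩ := hnt
    have key : ∀ X : Matrix (Fin 2) (Fin 2) k, ψ ((h⁻¹ * g - 1) * X).trace = 1 := by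
      intro X
      have h1 := H X
      have h2 : (g * X * h⁻¹).trace = ((h⁻¹ * g - 1) * X).trace + X.trace := by
        rw [Matrix.trace_mul_comm, ← Matrix.mul_assoc, Matrix.sub_mul, Matrix.trace_sub,
          Matrix.one_mul, sub_add_cancel]
      rw [h2, hψ] at h1
      exact mul_eq_right.mp h1
    have hA : h⁻¹ * g - 1 = 0 := by
      generalize h⁻¹ * g - 1 = A at key
      ext i j
      by_contra hne
      change A i j ≠ 0 at hne
      apply hx
      have h3 := key (Matrix.single j i (x / A i j))
      have h4 : (A * Matrix.single j i (x / A i j)).trace = x := by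
        have h5 : (A * Matrix.single j i (x / A i j)).trace = A i j * (x / A i j) := by
          fin_cases i <;> fin_cases j <;>
            simp [Matrix.trace, Matrix.mul_apply, Matrix.single_apply]
        rw [h5, mul_div_cancel₀ _ hne]
      rwa [h4] at h3
    have h6 : h⁻¹ * g = 1 := sub_eq_zero.mp hA
    calc g = h * (h⁻¹ * g) := by rw [Matrix.mul_nonsing_inv_cancel_left _ _ hdet]
      _ = h := by rw [h6, Matrix.mul_one]
  · rintro rfl X
    rw [Matrix.trace_mul_comm, ← Matrix.mul_assoc, Matrix.nonsing_inv_mul _ hdet, Matrix.one_mul]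
end

section
/- There is a unique group homomorphism ψ_S : S → ℂˣ such that ψ_S([[I,X,Z],[0,I,Y],[0,0,I]]) = ψ_k(−tr(X)) for every element [[I,X,Z],[0,I,Y],[0,0,I]] of U3, and ψ_S(Δ(g)) = 1 for every g ∈ GL2(k). -/
open Matrix Pointwise

variable {k : Type*} [Field k]

theorem blk_mul (M N : Fin 3 → Fin 3 → M2 k) :
    blk M * blk N = blk (fun i j => ∑ l, M i l * N l j) := by
  ext i j
  simp only [blk, Matrix.mul_apply, Matrix.of_apply, Fin.sum_univ_six, Fin.sum_univ_three,
    Matrix.add_apply, Fin.sum_univ_two]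
  simp only [← add_assoc]
  rfl

theorem DU (g X Y Z : M2 k) :
    Dmat g * Umat X Y Z = blk ![![g, g * X, g * Z], ![0, g, g * Y], ![0, 0, g]] := by
  unfold Dmat bdiag Umat
  rw [blk_mul]
  congr 1
  funext i j
  fin_cases i <;> fin_cases j <;> simp [Fin.sum_univ_three]

theorem D_one_s6 : Dmat (1 : M2 k) = 1 := by
  ext i j
  fin_cases i <;> fin_cases j <;> rfl

theorem U_one : Umat (0 : M2 k) 0 0 = 1 := by
  ext i j
  fin_cases i <;> fin_cases j <;> rfl

/-- upper-left block -/
def blkA (m : M6 k) : M2 k := !![m 0 0, m 0 1; m 1 0, m 1 1]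

/-- upper-middle block -/
def blkB (m : M6 k) : M2 k := !![m 0 2, m 0 3; m 1 2, m 1 3]

theorem blkA_blk (M : Fin 3 → Fin 3 → M2 k) : blkA (blk M) = M 0 0 := by
  ext i j
  fin_cases i <;> fin_cases j <;> rfl

theorem blkB_blk (M : Fin 3 → Fin 3 → M2 k) : blkB (blk M) = M 0 1 := by
  ext i j
  fin_cases i <;> fin_cases j <;> rfl

theorem mem_cases {m : M6 k} (h : m ∈ Sgrp k) : ∃ g X Y Z : M2 k, IsUnit g ∧
    X * Jmat + Jmat * Yᵀ = 0 ∧ Z * Jmat + Jmat * Zᵀ = -(X * Jmat * Xᵀ) ∧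
    m = Dmat g * Umat X Y Z := by
  obtain ⟨d, ⟨g, hg, rfl⟩, u, ⟨X, Y, Z, h1, h2, rfl⟩, rfl⟩ := Set.mem_mul.1 h
  exact ⟨g, X, Y, Z, hg, h1, h2, rfl⟩

theorem D_mem {g : M2 k} (hg : IsUnit g) : Dmat g ∈ Sgrp k :=
  Set.mem_mul.2 ⟨Dmat g, ⟨g, hg, rfl⟩, 1,
    ⟨0, 0, 0, by simp, by simp, U_one.symm⟩, by simp⟩

theorem U_mem {X Y Z : M2 k} (h1 : X * Jmat + Jmat * Yᵀ = 0)
    (h2 : Z * Jmat + Jmat * Zᵀ = -(X * Jmat * Xᵀ)) : Umat X Y Z ∈ Sgrp k :=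
  Set.mem_mul.2 ⟨1, ⟨1, isUnit_one, D_one_s6.symm⟩, Umat X Y Z, ⟨X, Y, Z, h1, h2, rfl⟩, by simp⟩

/-- the trace functional -/
noncomputable def trf (m : M6 k) : k := ((blkA m)⁻¹ * blkB m).trace

theorem trf_DU {g : M2 k} (hg : IsUnit g) (X Y Z : M2 k) :
    trf (Dmat g * Umat X Y Z) = X.trace := by
  have hd : IsUnit g.det := (Matrix.isUnit_iff_isUnit_det g).1 hg
  rw [DU, trf, blkA_blk, blkB_blk]
  change (g⁻¹ * (g * X)).trace = _
  rw [Matrix.nonsing_inv_mul_cancel_left _ _ hd]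

theorem trf_mul {x y : M6 k} (hx : x ∈ Sgrp k) (hy : y ∈ Sgrp k) :
    trf (x * y) = trf x + trf y := by
  obtain ⟨g, X, Y, Z, hg, -, -, rfl⟩ := mem_cases hx
  obtain ⟨h, X', Y', Z', hh, -, -, rfl⟩ := mem_cases hy
  have hd : IsUnit g.det := (Matrix.isUnit_iff_isUnit_det g).1 hg
  have hd' : IsUnit h.det := (Matrix.isUnit_iff_isUnit_det h).1 hh
  rw [trf_DU hg, trf_DU hh, DU, DU, blk_mul, trf, blkA_blk, blkB_blk]
  simp only [Fin.sum_univ_three]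
  simp only [Matrix.cons_val, mul_zero, add_zero, zero_mul]
  rw [Matrix.mul_inv_rev, mul_add, Matrix.trace_add, mul_assoc, mul_assoc g X h,
    Matrix.nonsing_inv_mul_cancel_left _ _ hd, mul_assoc, Matrix.nonsing_inv_mul_cancel_left _ _ hd,
    Matrix.nonsing_inv_mul_cancel_left _ _ hd', Matrix.trace_mul_comm,
    Matrix.mul_nonsing_inv_cancel_right _ _ hd', add_comm]

/-- There is a unique group homomorphism `ψ_S : S → ℂˣ` such that
`ψ_S([[I,X,Z],[0,I,Y],[0,0,I]]) = ψ_k(−tr X)` on `U3` and `ψ_S(Δ(g)) = 1` for `g ∈ GL2(k)`. -/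
theorem shalika_character_exists_unique (k : Type*) [Field k]
    (ψk : k → ℂˣ) (hψk : ∀ x y : k, ψk (x + y) = ψk x * ψk y) :
    ∃! f : {m : M6 k // m ∈ Sgrp k} → ℂˣ,
      (∀ (x y : {m : M6 k // m ∈ Sgrp k}) (h : (x : M6 k) * (y : M6 k) ∈ Sgrp k),
        f ⟨(x : M6 k) * (y : M6 k), h⟩ = f x * f y) ∧
      (∀ X Y Z : M2 k, X * Jmat + Jmat * Yᵀ = 0 →
        Z * Jmat + Jmat * Zᵀ = -(X * Jmat * Xᵀ) →
        ∀ h : Umat X Y Z ∈ Sgrp k, f ⟨Umat X Y Z, h⟩ = ψk (-(X.trace))) ∧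
      (∀ g : M2 k, IsUnit g → ∀ h : Dmat g ∈ Sgrp k, f ⟨Dmat g, h⟩ = 1) := by

  have h0 : ψk 0 = 1 := by
    have := hψk 0 0
    rw [add_zero] at this
    exact left_eq_mul.1 this
  refine ⟨fun m => ψk (-(trf m.1)), ⟨?_, ?_, ?_⟩, ?_⟩
  · intro x y h
    change ψk (-(trf (x.1 * y.1))) = _
    rw [trf_mul x.2 y.2, neg_add, hψk]
  · intro X Y Z _ _ h
    have := trf_DU (isUnit_one : IsUnit (1 : M2 k)) X Y Z
    rw [D_one_s6, one_mul] at this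
    change ψk (-(trf (Umat X Y Z))) = _
    rw [this]
  · intro g hg h
    have := trf_DU hg 0 0 0
    rw [U_one, mul_one] at this
    change ψk (-(trf (Dmat g))) = _
    rw [this, Matrix.trace_zero, neg_zero, h0]
  · rintro f ⟨hm, hU, hD⟩
    funext ⟨m, hmS⟩
    obtain ⟨g, X, Y, Z, hg, h1, h2, rfl⟩ := mem_cases hmS
    change _ = ψk (-(trf (Dmat g * Umat X Y Z)))
    rw [trf_DU hg, ← hU X Y Z h1 h2 (U_mem h1 h2)]
    have := hm ⟨Dmat g, D_mem hg⟩ ⟨Umat X Y Z, U_mem h1 h2⟩ hmS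
    rw [hD g hg, one_mul] at this
    exact this
end
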